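/- Let r₁, r₂, θ be real numbers with 0 < r₁ ≤ r₂ and 0 ≤ θ ≤ π. Then r₂² · ((log(r₂/r₁))² + θ²) ≥ r₁² + r₂² − 2·r₁·r₂·cos θ. -/

import Mathlib

/-- For `0 < r₁ ≤ r₂` and `0 ≤ θ ≤ π`:
`r₂²·((log(r₂/r₁))² + θ²) ≥ r₁² + r₂² − 2 r₁ r₂ cos θ`. -/
theorem stmt_6 (r₁ r₂ θ : ℝ) (hr₁ : 0 < r₁) (h12 : r₁ ≤ r₂)
    (hθ0 : 0 ≤ θ) (hθπ : θ ≤ Real.pi) :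
    r₂ ^ 2 * ((Real.log (r₂ / r₁)) ^ 2 + θ ^ 2)
      ≥ r₁ ^ 2 + r₂ ^ 2 - 2 * r₁ * r₂ * Real.cos θ := by
  have hr₂ : 0 < r₂ := hr₁.trans_le h12
  have hlog : r₂ - r₁ ≤ r₂ * Real.log (r₂ / r₁) := by
    have h := Real.one_sub_inv_le_log_of_pos (div_pos hr₂ hr₁)
    rw [inv_div] at h
    calc r₂ - r₁ = r₂ * (1 - r₁ / r₂) := by field_simp
      _ ≤ r₂ * Real.log (r₂ / r₁) := by gcongr
  have hradial : (r₂ - r₁) ^ 2 ≤ (r₂ * Real.log (r₂ / r₁)) ^ 2 :=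
    pow_le_pow_left₀ (sub_nonneg.2 h12) hlog 2
  have hcos : 2 * (1 - Real.cos θ) ≤ θ ^ 2 := by
    linarith [Real.one_sub_sq_div_two_le_cos (x := θ)]
  have hangular : r₁ * r₂ * (2 * (1 - Real.cos θ)) ≤ r₂ * r₂ * θ ^ 2 := by
    have := sub_nonneg.2 (Real.cos_le_one θ)
    gcongr
  linarith
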